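/- For every n ≥ 1, the minimum number of leaves of a hazard-free decision tree computing MUX_n satisfies 2·4^n ≤ size_u(MUX_n) ≤ 4^{n+1} − 3^n. -/

import Mathlib

/-- Kleene's three-valued domain: `none` is the unstable value `u`,
`some b` is a stable Boolean value. -/
abbrev K : Type := Option Bool

namespace HF

variable {ι : Type} [Fintype ι] [DecidableEq ι]

/-- Instability order on inputs: `Below x y` means `x ≤ y`, i.e. each coordinate of `x`
is either `u` or equal to the corresponding coordinate of `y`. -/
def Below (x y : ι → K) : Prop := ∀ i, x i = none ∨ x i = y i

/-- `x` is strictly below `y` in the instability order. -/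
def StrictBelow (x y : ι → K) : Prop := Below x y ∧ x ≠ y

/-- `y` is strictly above `x` in the instability order. -/
def StrictAbove (y x : ι → K) : Prop := Below x y ∧ y ≠ x

/-- `x : ι → Bool` is a resolution of `y : ι → K`. -/
def Resolves (y : ι → K) (x : ι → Bool) : Prop := ∀ i, y i = none ∨ y i = some (x i)

instance (y : ι → K) : DecidablePred (Resolves y) := fun x => by
  unfold Resolves; infer_instance

/-- The hazard-free extension of a Boolean function `f`. -/
def hfExt (f : (ι → Bool) → Bool) (y : ι → K) : K :=
  if ∀ x, Resolves y x → f x = true then some true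
  else if ∀ x, Resolves y x → f x = false then some false
  else none

/-- Number of unstable (`u`) coordinates of an input. -/
def numU (x : ι → K) : ℕ := (Finset.univ.filter fun i => x i = none).card

/-- Ternary (hazard-free) decision trees: leaves are labeled by values in `K`,
internal nodes query a position and have children for responses `0`, `u`, `1`. -/
inductive TDT (ι : Type) : Type where
  | leaf : K → TDT ι
  | node : ι → TDT ι → TDT ι → TDT ι → TDT ι

namespace TDT

/-- Evaluate a ternary decision tree on an input in `K^ι`. -/
def eval : TDT ι → (ι → K) → K
  | .leaf b, _ => b
  | .node i t0 tu t1, x =>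
    match x i with
    | some false => eval t0 x
    | none => eval tu x
    | some true => eval t1 x

/-- Depth of a ternary decision tree. -/
def depth : TDT ι → ℕ
  | .leaf _ => 0
  | .node _ t0 tu t1 => max (max (depth t0) (depth tu)) (depth t1) + 1

/-- Size (number of leaves) of a ternary decision tree. -/
def size : TDT ι → ℕ
  | .leaf _ => 1
  | .node _ t0 tu t1 => size t0 + size tu + size t1

end TDT

/-- Boolean decision trees. -/
inductive BDT (ι : Type) : Type where
  | leaf : Bool → BDT ι
  | node : ι → BDT ι → BDT ι → BDT ι

namespace BDT

/-- Evaluate a Boolean decision tree. -/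
def eval : BDT ι → (ι → Bool) → Bool
  | .leaf b, _ => b
  | .node i t0 t1, x => if x i then eval t1 x else eval t0 x

/-- Depth of a Boolean decision tree. -/
def depth : BDT ι → ℕ
  | .leaf _ => 0
  | .node _ t0 t1 => max (depth t0) (depth t1) + 1

/-- Size (number of leaves) of a Boolean decision tree. -/
def size : BDT ι → ℕ
  | .leaf _ => 1
  | .node _ t0 t1 => size t0 + size t1

end BDT

/-- A ternary tree computes (the hazard-free extension of) the Boolean function `f`. -/
def ComputesHF (f : (ι → Bool) → Bool) (T : TDT ι) : Prop := ∀ x, T.eval x = hfExt f x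

/-- A ternary tree computes a `K`-valued function `g`. -/
def ComputesT (g : (ι → K) → K) (T : TDT ι) : Prop := ∀ x, T.eval x = g x

/-- A Boolean tree computes the Boolean function `f`. -/
def ComputesB (f : (ι → Bool) → Bool) (T : BDT ι) : Prop := ∀ x, T.eval x = f x

/-- A `k`-bit hazard-free decision tree for `f`: correct on all inputs with at most
`k` unstable coordinates. -/
def KComputes (k : ℕ) (f : (ι → Bool) → Bool) (T : TDT ι) : Prop :=
  ∀ x : ι → K, numU x ≤ k → T.eval x = hfExt f x

/-- Minimum depth of a ternary decision tree computing a `K`-valued function. -/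
noncomputable def depthT (g : (ι → K) → K) : ℕ :=
  sInf {d | ∃ T : TDT ι, ComputesT g T ∧ T.depth = d}

/-- Hazard-free decision tree depth of a Boolean function. -/
noncomputable def depthU (f : (ι → Bool) → Bool) : ℕ :=
  sInf {d | ∃ T : TDT ι, ComputesHF f T ∧ T.depth = d}

/-- Hazard-free decision tree size (minimum number of leaves). -/
noncomputable def sizeU (f : (ι → Bool) → Bool) : ℕ :=
  sInf {s | ∃ T : TDT ι, ComputesHF f T ∧ T.size = s}

/-- Boolean decision tree size (minimum number of leaves). -/
noncomputable def sizeB (f : (ι → Bool) → Bool) : ℕ :=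
  sInf {s | ∃ T : BDT ι, ComputesB f T ∧ T.size = s}

/-- The multiplexer function `MUX n` on `n` selector bits and `2^n` data bits. -/
def MUX (n : ℕ) (z : (Fin n ⊕ (Fin n → Bool)) → Bool) : Bool :=
  z (Sum.inr fun i => z (Sum.inl i))

/-- Hazard-free sensitivity of `g` at `x`. -/
noncomputable def sensAt (g : (ι → K) → K) (x : ι → K) : ℕ :=
  Set.ncard {i : ι | ∃ y : ι → K, y i ≠ x i ∧ (∀ j, j ≠ i → y j = x j) ∧ g y ≠ g x}

/-- Hazard-free sensitivity of `g`. -/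
noncomputable def sens (g : (ι → K) → K) : ℕ := ⨆ x : ι → K, sensAt g x

/-- Hazard-free sensitivity of `g` restricted to inputs with output value `b`. -/
noncomputable def sensVal (g : (ι → K) → K) (b : K) : ℕ :=
  ⨆ x : {x : ι → K // g x = b}, sensAt g x.1

/-- Hazard-free block sensitivity of `g` at `x`. -/
noncomputable def bsensAt (g : (ι → K) → K) (x : ι → K) : ℕ :=
  sSup {k : ℕ | ∃ B : Fin k → Finset ι, (∀ j, (B j).Nonempty) ∧
    (∀ j j', j ≠ j' → Disjoint (B j) (B j')) ∧
    ∀ j, ∃ y : ι → K, (∀ i, y i ≠ x i ↔ i ∈ B j) ∧ g y ≠ g x}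

/-- Hazard-free block sensitivity of `g`. -/
noncomputable def bsens (g : (ι → K) → K) : ℕ := ⨆ x, bsensAt g x

/-- Hazard-free certificate complexity of `g` at `x`. -/
noncomputable def ccAt (g : (ι → K) → K) (x : ι → K) : ℕ :=
  sInf {k : ℕ | ∃ S : Finset ι, S.card = k ∧
    ∀ y : ι → K, (∀ i ∈ S, y i = x i) → g y = g x}

/-- Hazard-free certificate complexity of `g`. -/
noncomputable def cc (g : (ι → K) → K) : ℕ := ⨆ x, ccAt g x

/-- Hazard-free certificate complexity of `g` restricted to inputs with output value `b`. -/
noncomputable def ccVal (g : (ι → K) → K) (b : K) : ℕ :=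
  ⨆ x : {x : ι → K // g x = b}, ccAt g x.1

/-- Boolean sensitivity of a Boolean function. -/
noncomputable def boolSens (f : (ι → Bool) → Bool) : ℕ :=
  ⨆ x : ι → Bool, Set.ncard {i : ι | f (Function.update x i (!(x i))) ≠ f x}

/-- `p` is a prime implicant of `f`. -/
def PrimeImplicant (f : (ι → Bool) → Bool) (p : ι → K) : Prop :=
  hfExt f p = some true ∧ ∀ q, StrictBelow q p → hfExt f q ≠ some true

/-- `p` is a prime implicate of `f`. -/
def PrimeImplicate (f : (ι → Bool) → Bool) (p : ι → K) : Prop :=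
  hfExt f p = some false ∧ ∀ q, StrictBelow q p → hfExt f q ≠ some false

/-- Size of an implicant/implicate: the number of stable coordinates. -/
noncomputable def isize (p : ι → K) : ℕ := Set.ncard {i : ι | p i ≠ none}

/-- Hamming distance between two inputs in `K^ι`. -/
noncomputable def hamm (x y : ι → K) : ℕ := Set.ncard {i : ι | x i ≠ y i}

/-- Hazard-free evaluation of a literal (variable and polarity). -/
def litEval (x : ι → K) (l : ι × Bool) : K := if l.2 then x l.1 else (x l.1).map not

/-- Hazard-free evaluation of a term (conjunction of literals). -/
def termEval (t : Finset (ι × Bool)) (x : ι → K) : K :=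
  if ∀ l ∈ t, litEval x l = some true then some true
  else if ∃ l ∈ t, litEval x l = some false then some false
  else none

/-- Hazard-free evaluation of a clause (disjunction of literals). -/
def clauseEval (c : Finset (ι × Bool)) (x : ι → K) : K :=
  if ∃ l ∈ c, litEval x l = some true then some true
  else if ∀ l ∈ c, litEval x l = some false then some false
  else none

/-- Hazard-free evaluation of a DNF formula (a set of terms). -/
def dnfEval (D : Finset (Finset (ι × Bool))) (x : ι → K) : K :=
  if ∃ t ∈ D, termEval t x = some true then some true
  else if ∀ t ∈ D, termEval t x = some false then some false
  else none

/-- Hazard-free evaluation of a CNF formula (a set of clauses). -/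
def cnfEval (C : Finset (Finset (ι × Bool))) (x : ι → K) : K :=
  if ∀ c ∈ C, clauseEval c x = some true then some true
  else if ∃ c ∈ C, clauseEval c x = some false then some false
  else none

/-- A function `g : K^ι → K` is weakly hazard-free: it is monotone with respect to the
instability order, and whenever all points strictly above `x` have the same value `b`
(and some such point exists), `g x = b` as well. -/
def WeaklyHF (g : (ι → K) → K) : Prop :=
  (∀ x y, Below x y → g x = none ∨ g x = g y) ∧
  (∀ x (b : K), (∃ y, StrictAbove y x) → (∀ y, StrictAbove y x → g y = b) → g x = b)

/-- The subcube `C(x)` is monochromatic for `f`. -/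
def Mono (f : (ι → Bool) → Bool) (x : ι → K) : Prop :=
  ∀ y z : ι → Bool, Resolves x y → Resolves x z → f y = f z

/-- The subcube `C(x)` is colorful for `f` (contains both a 0-point and a 1-point). -/
def Colorful (f : (ι → Bool) → Bool) (x : ι → K) : Prop :=
  ∃ y z : ι → Bool, Resolves x y ∧ Resolves x z ∧ f y ≠ f z

/-- `C(x)` is a minimal colorful cube for `f`. -/
def MinColorful (f : (ι → Bool) → Bool) (x : ι → K) : Prop :=
  Colorful f x ∧ ∀ i, x i = none →
    (Mono f (Function.update x i (some false)) ∨ Mono f (Function.update x i (some true)))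

/-- A Boolean function is non-degenerate if it depends on every input position. -/
def Nondegenerate (f : (ι → Bool) → Bool) : Prop :=
  ∀ i : ι, ∃ x y : ι → Bool, (∀ j, j ≠ i → x j = y j) ∧ x i ≠ y i ∧ f x ≠ f y

/-- The `n`-input AND function. -/
def ANDf (n : ℕ) (x : Fin n → Bool) : Bool := decide (∀ i, x i = true)

/-- The value of `T` changes when the `i`-th coordinate of `x` is changed suitably. -/
def TDT.Sensitive (T : TDT ι) (x : ι → K) (i : ι) : Prop :=
  ∃ v : K, T.eval (Function.update x i v) ≠ T.eval x

/-- The child of a node selected by a response. -/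
def TDT.child (t0 tu t1 : TDT ι) : K → TDT ι
  | some false => t0
  | none => tu
  | some true => t1

lemma TDT.eval_node {κ : Type} (i : κ) (t0 tu t1 : TDT κ) (x : κ → K) :
    (TDT.node i t0 tu t1).eval x = (TDT.child t0 tu t1 (x i)).eval x := by
  rcases h : x i with _ | _ | _ <;> simp [TDT.eval, TDT.child, h]

lemma TDT.Sensitive.child_of_ne {κ : Type} [DecidableEq κ] {i j : κ} {t0 tu t1 : TDT κ} {x : κ → K}
    (h : (TDT.node i t0 tu t1).Sensitive x j) (hij : j ≠ i) :
    (TDT.child t0 tu t1 (x i)).Sensitive x j := by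
  obtain ⟨v, hv⟩ := h
  refine ⟨v, ?_⟩
  rwa [TDT.eval_node, TDT.eval_node, Function.update_of_ne hij.symm] at hv

/-- If any two members of a family of inputs differ at a coordinate which is sensitive for one of
them, then all members reach different leaves. -/
lemma TDT.card_le_size {κ : Type} [DecidableEq κ] {α : Type} [DecidableEq α] (z : α → κ → K) (T : TDT κ) :
    ∀ S : Finset α,
      (∀ s ∈ S, ∀ t ∈ S, s ≠ t →
        ∃ i, z s i ≠ z t i ∧ (T.Sensitive (z s) i ∨ T.Sensitive (z t) i)) →
      S.card ≤ T.size := by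
  induction T with
  | leaf b =>
    intro S hS
    refine Finset.card_le_one.2 fun s hs t ht => ?_
    by_contra hst
    obtain ⟨i, -, ⟨v, hv⟩ | ⟨v, hv⟩⟩ := hS s hs t ht hst <;> exact hv rfl
  | node i t0 tu t1 ih0 ihu ih1 =>
    intro S hS
    have fiber : ∀ c : K, ∀ s ∈ S.filter (fun s => z s i = c),
        ∀ t ∈ S.filter (fun s => z s i = c), s ≠ t →
        ∃ j, z s j ≠ z t j ∧ ((TDT.child t0 tu t1 c).Sensitive (z s) j ∨
          (TDT.child t0 tu t1 c).Sensitive (z t) j) := by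
      intro c s hs t ht hst
      rw [Finset.mem_filter] at hs ht
      obtain ⟨j, hj, h⟩ := hS s hs.1 t ht.1 hst
      have hji : j ≠ i := by
        rintro rfl
        exact hj (hs.2.trans ht.2.symm)
      refine ⟨j, hj, h.imp (fun h => ?_) (fun h => ?_)⟩
      · simpa [hs.2] using h.child_of_ne hji
      · simpa [ht.2] using h.child_of_ne hji
    have h0 := ih0 _ (fiber (some false))
    have hu := ihu _ (fiber none)
    have h1 := ih1 _ (fiber (some true))
    have hcover : S ⊆ S.filter (fun s => z s i = some false) ∪ S.filter (fun s => z s i = none) ∪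
        S.filter (fun s => z s i = some true) := by
      intro s hs
      rcases h : z s i with _ | _ | _ <;> simp [hs, h]
    have := Finset.card_le_card hcover
    have := Finset.card_union_le (S.filter (fun s => z s i = some false) ∪
      S.filter (fun s => z s i = none)) (S.filter (fun s => z s i = some true))
    have := Finset.card_union_le (S.filter (fun s => z s i = some false))
      (S.filter (fun s => z s i = none))
    simp only [TDT.size]
    omega

lemma exists_resolves {κ : Type} (y : κ → K) : ∃ x, Resolves y x :=
  ⟨fun i => (y i).getD false, fun i => by rcases h : y i with _ | b <;> simp [h]⟩

lemma hfExt_eq_some_iff (f : (ι → Bool) → Bool) (y : ι → K) (b : Bool) :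
    hfExt f y = some b ↔ ∀ x, Resolves y x → f x = b := by
  obtain ⟨x₀, hx₀⟩ := exists_resolves y
  unfold hfExt
  split_ifs with h1 h0
  · cases b
    · simp only [Option.some.injEq, Bool.true_eq_false, false_iff, not_forall]
      exact ⟨x₀, hx₀, by simp [h1 x₀ hx₀]⟩
    · simpa using h1
  · cases b
    · simpa using h0
    · simp only [Option.some.injEq, Bool.false_eq_true, false_iff]
      exact h1
  · cases b
    · simpa using h0
    · simpa using h1

/-- `MUX n` is stably `b` iff all data bits addressable by the selector are stably `b`. -/
lemma hfExt_MUX_eq_some_iff {n : ℕ} (y : Fin n ⊕ (Fin n → Bool) → K) (b : Bool) :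
    hfExt (MUX n) y = some b ↔
      ∀ c : Fin n → Bool, Resolves (fun i => y (Sum.inl i)) c → y (Sum.inr c) = some b := by
  rw [hfExt_eq_some_iff]
  constructor
  · intro h c hc
    have h' := h (Sum.elim c fun d => (y (Sum.inr d)).getD (!b)) ?_
    · simp only [MUX, Sum.elim_inr, Sum.elim_inl] at h'
      rcases hy : y (Sum.inr c) with _ | v <;> simp_all
    · rintro (i | d)
      · exact hc i
      · rcases hy : y (Sum.inr d) with _ | v <;> simp [hy]
  · intro h x hx
    have h' := h (fun i => x (Sum.inl i)) fun i => hx (Sum.inl i)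
    rcases hx (Sum.inr fun i => x (Sum.inl i)) with h0 | h0 <;> simp_all [MUX]

/-- The selector equals `a` with the positions in `U` made unstable; the data bit at `a` is `c`,
and all other data bits are `1`. -/
def muxInput {n : ℕ} (a U : Fin n → Bool) (c : K) : Fin n ⊕ (Fin n → Bool) → K :=
  Sum.elim (fun i => if U i then none else some (a i))
    (fun d => if d = a then c else some true)

lemma resolves_muxInput {n : ℕ} (a U : Fin n → Bool) (c : K) :
    Resolves (fun i => muxInput a U c (Sum.inl i)) a := fun i => by
  by_cases h : U i <;> simp [muxInput, h]

lemma hfExt_muxInput_ne {n : ℕ} (a U : Fin n → Bool) {c : K} (hc : c ≠ some true) :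
    hfExt (MUX n) (muxInput a U c) ≠ some true := by
  rw [Ne, hfExt_MUX_eq_some_iff]
  intro h
  exact hc (by simpa [muxInput] using h a (resolves_muxInput a U c))

lemma sensitive_muxInput_data {n : ℕ} {T : TDT (Fin n ⊕ (Fin n → Bool))}
    (hT : ComputesHF (MUX n) T) (a U : Fin n → Bool) {c : K} (hc : c ≠ some true) :
    T.Sensitive (muxInput a U c) (Sum.inr a) := by
  refine ⟨some true, ?_⟩
  rw [hT, hT, (hfExt_MUX_eq_some_iff _ true).2]
  · exact (hfExt_muxInput_ne a U hc).symm
  · intro d _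
    by_cases h : d = a
    · subst h; simp
    · simp [muxInput, h]

lemma sensitive_muxInput_selector {n : ℕ} {T : TDT (Fin n ⊕ (Fin n → Bool))}
    (hT : ComputesHF (MUX n) T) (a U : Fin n → Bool) {c : K} (hc : c ≠ some true) (i : Fin n) :
    T.Sensitive (muxInput a U c) (Sum.inl i) := by
  refine ⟨some (!a i), ?_⟩
  rw [hT, hT, (hfExt_MUX_eq_some_iff _ true).2]
  · exact (hfExt_muxInput_ne a U hc).symm
  · intro d hd
    have h : d ≠ a := by
      rintro rfl
      simpa using hd i
    simp [muxInput, h]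

lemma two_mul_four_pow_le_size {n : ℕ} {T : TDT (Fin n ⊕ (Fin n → Bool))}
    (hT : ComputesHF (MUX n) T) : 2 * 4 ^ n ≤ T.size := by
  let val : Bool → K := fun b => if b then none else some false
  have hval : ∀ b, val b ≠ some true := by decide
  have hinj : ∀ b b', val b = val b' → b = b' := by decide
  have h := T.card_le_size (α := (Fin n → Bool) × (Fin n → Bool) × Bool)
    (fun s => muxInput s.1 s.2.1 (val s.2.2)) Finset.univ ?_
  · have hcard : 2 * 4 ^ n = 2 ^ n * (2 ^ n * 2) := by
      rw [← mul_assoc, ← mul_pow, mul_comm]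
      norm_num
    simpa [hcard] using h
  · rintro ⟨a, U, b⟩ - ⟨a', U', b'⟩ - hne
    by_cases hab : a = a' ∧ b = b'
    · obtain ⟨rfl, rfl⟩ := hab
      have hU : U ≠ U' := by
        rintro rfl
        exact hne rfl
      obtain ⟨i, hi⟩ := Function.ne_iff.1 hU
      refine ⟨Sum.inl i, ?_, Or.inl (sensitive_muxInput_selector hT a U (hval b) i)⟩
      cases h : U i <;> cases h' : U' i <;> simp_all [muxInput]
    · refine ⟨Sum.inr a, ?_, Or.inl (sensitive_muxInput_data hT a U (hval b))⟩
      by_cases ha : a = a'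
      · subst ha
        simp only [muxInput, Sum.elim_inr, if_true]
        exact fun h => hab ⟨rfl, hinj _ _ h⟩
      · simpa [muxInput, ha] using hval b

/-- Checks that all data bits listed in `L` equal `b`. -/
def checkTree {n : ℕ} (b : Bool) : List (Fin n → Bool) → TDT (Fin n ⊕ (Fin n → Bool))
  | [] => .leaf (some b)
  | a :: L =>
    if b then .node (Sum.inr a) (.leaf none) (.leaf none) (checkTree b L)
    else .node (Sum.inr a) (checkTree b L) (.leaf none) (.leaf none)

/-- Determines the common stable value, if any, of the data bits listed in `L`. -/
def dataTree {n : ℕ} : List (Fin n → Bool) → TDT (Fin n ⊕ (Fin n → Bool))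
  | [] => .leaf none
  | a :: L => .node (Sum.inr a) (checkTree false L) (.leaf none) (checkTree true L)

/-- Queries the selector positions in `l`, maintaining the list of addresses that remain possible,
and then reads the data bits at these addresses. -/
def selectorTree {n : ℕ} :
    List (Fin n) → List (Fin n → Bool) → TDT (Fin n ⊕ (Fin n → Bool))
  | [], L => dataTree L
  | i :: l, L =>
    let L0 := L.map fun a => Function.update a i false
    let L1 := L.map fun a => Function.update a i true
    .node (Sum.inl i) (selectorTree l L0) (selectorTree l (L0 ++ L1)) (selectorTree l L1)

lemma size_checkTree {n : ℕ} (b : Bool) (L : List (Fin n → Bool)) :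
    (checkTree b L).size = 2 * L.length + 1 := by
  induction L with
  | nil => rfl
  | cons a L ih => cases b <;> simp [checkTree, TDT.size, ih] <;> ring

lemma size_dataTree {n : ℕ} {L : List (Fin n → Bool)} (hL : L ≠ []) :
    (dataTree L).size + 1 = 4 * L.length := by
  cases L with
  | nil => exact absurd rfl hL
  | cons a L => simp [dataTree, TDT.size, size_checkTree]; ring

lemma size_selectorTree {n : ℕ} (l : List (Fin n)) :
    ∀ L : List (Fin n → Bool), L ≠ [] →
      (selectorTree l L).size + 3 ^ l.length = 4 ^ (l.length + 1) * L.length := by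
  induction l with
  | nil => intro L hL; simpa [selectorTree] using size_dataTree hL
  | cons i l ih =>
    intro L hL
    have h0 := ih (L.map fun a => Function.update a i false) (by simpa using hL)
    have h1 := ih (L.map fun a => Function.update a i true) (by simpa using hL)
    have hu := ih ((L.map fun a => Function.update a i false) ++
      L.map fun a => Function.update a i true) (by simpa using hL)
    simp only [List.length_append, List.length_map] at h0 h1 hu
    simp only [selectorTree, TDT.size, List.length_cons, pow_succ] at *
    linarith

lemma eval_checkTree_eq_some_iff {n : ℕ} (b v : Bool) (L : List (Fin n → Bool))
    (x : Fin n ⊕ (Fin n → Bool) → K) :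
    (checkTree b L).eval x = some v ↔ b = v ∧ ∀ a ∈ L, x (Sum.inr a) = some b := by
  induction L with
  | nil => simp [checkTree, TDT.eval]
  | cons a L ih =>
    cases b <;> rcases h : x (Sum.inr a) with _ | _ | _ <;>
      simp [checkTree, TDT.eval, h, ih]

lemma eval_dataTree_eq_some_iff {n : ℕ} {L : List (Fin n → Bool)} (hL : L ≠ []) (v : Bool)
    (x : Fin n ⊕ (Fin n → Bool) → K) :
    (dataTree L).eval x = some v ↔ ∀ a ∈ L, x (Sum.inr a) = some v := by
  cases L with
  | nil => exact absurd rfl hL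
  | cons a L =>
    cases v <;> rcases h : x (Sum.inr a) with _ | _ | _ <;>
      simp [dataTree, TDT.eval, h, eval_checkTree_eq_some_iff]

/-- The address `c` is compatible with the selector values of `x` at the positions in `l` and
agrees with `a` elsewhere. -/
def Compat {n : ℕ} (x : Fin n ⊕ (Fin n → Bool) → K) (l : List (Fin n))
    (a c : Fin n → Bool) : Prop :=
  ∀ i, if i ∈ l then x (Sum.inl i) = none ∨ x (Sum.inl i) = some (c i) else c i = a i

lemma compat_cons_iff {n : ℕ} (x : Fin n ⊕ (Fin n → Bool) → K) {i : Fin n} {l : List (Fin n)}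
    (hi : i ∉ l) (a c : Fin n → Bool) :
    Compat x (i :: l) a c ↔ ∃ b : Bool, (x (Sum.inl i) = none ∨ x (Sum.inl i) = some b) ∧
      Compat x l (Function.update a i b) c := by
  constructor
  · intro h
    refine ⟨c i, by simpa using h i, fun j => ?_⟩
    by_cases hji : j = i
    · subst hji; simp [hi]
    · simpa [hji] using h j
  · rintro ⟨b, hb, h⟩ j
    by_cases hji : j = i
    · subst hji
      have hj := h j
      simp only [hi, if_false, Function.update_self] at hj
      simpa [hj] using hb
    · simpa [hji] using h j

lemma eval_selectorTree_eq_some_iff {n : ℕ} (v : Bool) (x : Fin n ⊕ (Fin n → Bool) → K)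
    (l : List (Fin n)) (hl : l.Nodup) :
    ∀ L : List (Fin n → Bool), L ≠ [] →
      ((selectorTree l L).eval x = some v ↔
        ∀ c, (∃ a ∈ L, Compat x l a c) → x (Sum.inr c) = some v) := by
  induction l with
  | nil =>
    intro L hL
    have hc : ∀ a c, Compat x [] a c ↔ c = a := fun a c => by simp [Compat, funext_iff]
    simp only [selectorTree, eval_dataTree_eq_some_iff hL, hc, exists_eq_right']
  | cons i l ih =>
    intro L hL
    rw [List.nodup_cons] at hl
    have ih := ih hl.2
    simp only [compat_cons_iff x hl.1, selectorTree, TDT.eval]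
    rcases h : x (Sum.inl i) with _ | _ | _ <;> simp only
    all_goals
      rw [ih _ (by simpa using hL)]
      refine forall_congr' fun c => imp_congr_left ?_
      simp [or_and_right, exists_or, and_or_left]

lemma exists_computesHF_MUX (n : ℕ) : ∃ T : TDT (Fin n ⊕ (Fin n → Bool)),
    ComputesHF (MUX n) T ∧ T.size ≤ 4 ^ (n + 1) - 3 ^ n := by
  refine ⟨selectorTree (List.finRange n) [fun _ => false], fun x => ?_, ?_⟩
  · have h : ∀ v : Bool, (selectorTree (List.finRange n) [fun _ => false]).eval x = some v ↔
        hfExt (MUX n) x = some v := fun v => by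
      rw [eval_selectorTree_eq_some_iff v x _ (List.nodup_finRange n) _ (by simp),
        hfExt_MUX_eq_some_iff]
      simp [Compat, Resolves]
    exact Option.ext h
  · have h := size_selectorTree (List.finRange n) [fun _ => false] (by simp)
    simp only [List.length_finRange, List.length_singleton, mul_one] at h
    omega

/-- `2·4^n ≤ size_u(MUX_n) ≤ 4^{n+1} − 3^n`. -/
theorem mux_hazard_free_size (n : ℕ) (hn : 1 ≤ n) :
    (∀ T : TDT (Fin n ⊕ (Fin n → Bool)), ComputesHF (MUX n) T → 2 * 4 ^ n ≤ T.size) ∧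
    (∃ T : TDT (Fin n ⊕ (Fin n → Bool)), ComputesHF (MUX n) T ∧
      T.size ≤ 4 ^ (n + 1) - 3 ^ n) :=
  ⟨fun _ hT => two_mul_four_pow_le_size hT, exists_computesHF_MUX n⟩

end HF
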